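/- Let ⟨μ,d⟩ be a generating tuple with degree-monotone weights, let H ∈ ℛℋ(μ,d) be a directed Huffman tree with star sequence S₁,…,S_q, and let m₁ be the center of S₁. If ⟨μ′,d′⟩ is the tuple induced by the m₁-rollup H̲ of H, then H̲ ∈ ℛℋ(μ′,d′); that is, the m₁-rollup of a Huffman tree is a Huffman tree for the induced generating tuple. -/

import Mathlib

open scoped Classical
noncomputable section

/-- A directed tree on a finite vertex set `V`: each vertex has an outbound arc to its
`parent`, the `root` is a fixed point of `parent` (i.e. has no genuine outbound arc), and
every vertex reaches the root by iterating `parent`. -/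
structure DirTree (V : Type) [Fintype V] [DecidableEq V] where
  root : V
  parent : V → V
  parent_root : parent root = root
  reaches : ∀ v, ∃ n, parent^[n] v = root

variable {V : Type} [Fintype V] [DecidableEq V]

namespace DirTree

/-- `u` belongs to the subordinate group of `v`: there is a directed path from `u` to `v`. -/
def Desc (T : DirTree V) (u v : V) : Prop := ∃ n, T.parent^[n] u = v

/-- The set of vertices with an arc to `v`. -/
def children (T : DirTree V) (v : V) : Finset V :=
  Finset.univ.filter fun u => T.parent u = v ∧ u ≠ v

/-- Weight `f_T(v)` of the subordinate group of `v`. -/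
def f (T : DirTree V) (μ : V → ℝ) (v : V) : ℝ :=
  ∑ u ∈ Finset.univ.filter (fun u => T.Desc u v), μ u

/-- Degree of `v` in the underlying undirected tree. -/
def deg (T : DirTree V) (v : V) : ℕ :=
  (T.children v).card + (if v = T.root then 0 else 1)

/-- The underlying undirected tree. -/
def toGraph (T : DirTree V) : SimpleGraph V :=
  SimpleGraph.fromRel fun u v => T.parent u = v ∧ u ≠ v

/-- The vector (as a multiset, i.e. up to ascending rearrangement) of subordinate
groups' weights of internal non-root vertices. -/
def fvec (T : DirTree V) (μ : V → ℝ) : Multiset ℝ :=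
  (Finset.univ.filter fun m => 1 < T.deg m ∧ m ≠ T.root).val.map (T.f μ)

end DirTree

/-- Degree of a vertex in a simple graph. -/
def gdeg (G : SimpleGraph V) (v : V) : ℕ :=
  (Finset.univ.filter fun u => G.Adj v u).card

/-- `⟨μ, d⟩` is a generating tuple: nonnegative weights, degrees at least 1 summing to
`2(|V|-1)`, at least two pendent and at least one internal vertex. -/
structure IsGenTuple (μ : V → ℝ) (d : V → ℕ) : Prop where
  nonneg : ∀ v, 0 ≤ μ v
  deg_pos : ∀ v, 1 ≤ d v
  sum_deg : ∑ v, d v = 2 * (Fintype.card V - 1)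
  two_le_pendent : 2 ≤ (Finset.univ.filter fun v => d v = 1).card
  one_le_internal : 1 ≤ (Finset.univ.filter fun v => 1 < d v).card

/-- Weights are degree-monotone in `⟨μ, d⟩`. -/
def DegMonotone (μ : V → ℝ) (d : V → ℕ) : Prop :=
  (∀ m m', 1 < d m → 1 < d m' → d m < d m' → μ m ≤ μ m') ∧
  ∀ v, d v = 1 → 0 < μ v

/-- `T ∈ ℛ(μ,d)`: directed tree with internal root whose (undirected) degrees match `d`. -/
def memR (T : DirTree V) (d : V → ℕ) : Prop :=
  1 < d T.root ∧ ∀ v, T.deg v = d v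

/-- `G ∈ 𝒯(μ,d)`: `G` is a tree whose degrees match `d`. -/
def memT (G : SimpleGraph V) (d : V → ℕ) : Prop :=
  G.IsTree ∧ ∀ v, gdeg G v = d v

/-- Vertex-weighted Wiener index. -/
def VWWI (μ : V → ℝ) (G : SimpleGraph V) : ℝ :=
  (1 / 2) * ∑ u, ∑ v, μ u * μ v * (G.dist u v : ℝ)

/-- `S = (m, L)` is a minimal star for the state `(U, μ, d)`: the center `m` is an
internal vertex of `U` of least degree among internal vertices of least weight, and the
`d m - 1` leaves `L` are pendent vertices of `U` of least weights. -/
def IsMinimalStar (U : Finset V) (μ : V → ℝ) (d : V → ℕ) (m : V) (L : Finset V) : Prop :=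
  m ∈ U ∧ 1 < d m ∧ L ⊆ U ∧ m ∉ L ∧ L.card = d m - 1 ∧
  (∀ v ∈ L, d v = 1) ∧
  (∀ m' ∈ U, 1 < d m' → μ m ≤ μ m') ∧
  (∀ m' ∈ U, 1 < d m' → μ m' = μ m → d m ≤ d m') ∧
  ∀ u ∈ L, ∀ w ∈ U, d w = 1 → w ∉ L → μ u ≤ μ w

/-- Centers used before step `i` (0-indexed). -/
def usedCenters {q : ℕ} (c : Fin q → V) (i : ℕ) : Finset V :=
  (Finset.univ.filter fun j : Fin q => (j : ℕ) < i).image c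

/-- Vertex set `V_{i+1}` of the state of the Huffman algorithm before (0-indexed) step `i`,
for the candidate Huffman tree `T` with star centers `c`. -/
def stateV (T : DirTree V) {q : ℕ} (c : Fin q → V) (i : ℕ) : Finset V :=
  Finset.univ \ (Finset.univ.filter fun j : Fin q => (j : ℕ) < i).biUnion fun j => T.children (c j)

/-- Weight function `μ^{i+1}` of the state before (0-indexed) step `i`. -/
def stateMu (T : DirTree V) (μ : V → ℝ) {q : ℕ} (c : Fin q → V) (i : ℕ) : V → ℝ :=
  fun v => if v ∈ usedCenters c i then T.f μ v else μ v

/-- Degree function `d^{i+1}` of the state before (0-indexed) step `i`. -/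
def stateD (d : V → ℕ) {q : ℕ} (c : Fin q → V) (i : ℕ) : V → ℕ :=
  fun v => if v ∈ usedCenters c i then 1 else d v

/-- `T` is a directed Huffman tree for `⟨μ, d⟩` whose star sequence has centers
`c 0, …, c (q-1)` (so `S_i` has leaf set `children (c i)`): the centers enumerate the
internal vertices, the root is the last center, and at each of the first `q - 1` steps
the corresponding star is a minimal star of the current state. -/
def IsHuffmanSeq (μ : V → ℝ) (d : V → ℕ) (T : DirTree V) {q : ℕ} (c : Fin q → V) : Prop :=
  (∀ v, T.deg v = d v) ∧
  Function.Injective c ∧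
  (∀ v, 1 < d v ↔ ∃ j, c j = v) ∧
  (∀ hq : 0 < q, T.root = c ⟨q - 1, Nat.sub_lt hq Nat.one_pos⟩) ∧
  ∀ i : Fin q, (i : ℕ) < q - 1 →
    IsMinimalStar (stateV T c (i : ℕ)) (stateMu T μ c (i : ℕ)) (stateD d c (i : ℕ))
      (c i) (T.children (c i))

/-- `T ∈ ℛℋ(μ,d)`: `T` is a directed Huffman tree for `⟨μ, d⟩`. -/
def IsHuffmanDir (μ : V → ℝ) (d : V → ℕ) (T : DirTree V) : Prop :=
  ∃ (q : ℕ) (c : Fin q → V), IsHuffmanSeq μ d T c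

/-- Sum of the `k` smallest components of a multiset of reals. -/
def ascSum (s : Multiset ℝ) (k : ℕ) : ℝ := ((s.sort (· ≤ ·)).take k).sum

/-- `x` weakly majorizes `y` (`y ⪯^w x`). -/
def WMaj (x y : Multiset ℝ) : Prop :=
  Multiset.card x = Multiset.card y ∧ ∀ k, ascSum x k ≤ ascSum y k

/-- `x` strictly weakly majorizes `y` (`y ≺^w x`). -/
def SWMaj (x y : Multiset ℝ) : Prop := WMaj x y ∧ x ≠ y

namespace DirTree

theorem Desc.trans {T : DirTree V} {u v w : V} (huv : T.Desc u v) (hvw : T.Desc v w) :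
    T.Desc u w := by
  obtain ⟨n, rfl⟩ := huv
  obtain ⟨m, rfl⟩ := hvw
  exact ⟨m + n, Function.iterate_add_apply _ _ _ _⟩

/-- Two vertices on the directed path starting at `u` are comparable. -/
theorem Desc.total {T : DirTree V} {u v w : V} (huv : T.Desc u v) (huw : T.Desc u w) :
    T.Desc v w ∨ T.Desc w v := by
  obtain ⟨n, rfl⟩ := huv
  obtain ⟨m, rfl⟩ := huw
  rcases le_total n m with h | h
  · exact Or.inl ⟨m - n, by rw [← Function.iterate_add_apply, Nat.sub_add_cancel h]⟩
  · exact Or.inr ⟨n - m, by rw [← Function.iterate_add_apply, Nat.sub_add_cancel h]⟩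

theorem desc_iff_eq_or_desc_parent {T : DirTree V} {u v : V} :
    T.Desc u v ↔ u = v ∨ T.Desc (T.parent u) v := by
  constructor
  · rintro ⟨_ | n, h⟩
    · exact Or.inl h
    · exact Or.inr ⟨n, h⟩
  · rintro (rfl | ⟨n, h⟩)
    · exact ⟨0, rfl⟩
    · exact ⟨n + 1, h⟩

theorem mem_children {T : DirTree V} {u v : V} :
    u ∈ T.children v ↔ T.parent u = v ∧ u ≠ v := by
  simp [children]

theorem desc_of_mem_children {T : DirTree V} {u v : V} (h : u ∈ T.children v) : T.Desc u v :=
  ⟨1, (mem_children.1 h).1⟩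

/-- If all children of `a` are non-root vertices of degree one, then only `a` and its children
are subordinate to `a`. -/
theorem desc_iff_of_children_pendent {T : DirTree V} {a : V}
    (h : ∀ v ∈ T.children a, T.deg v = 1 ∧ v ≠ T.root) (v : V) :
    T.Desc v a ↔ v = a ∨ v ∈ T.children a := by
  refine ⟨?_, ?_⟩
  · rintro ⟨n, hn⟩
    induction n generalizing v with
    | zero => exact Or.inl hn
    | succ n ih =>
      rw [or_iff_not_imp_left]
      intro hva
      rcases ih _ hn with hp | hp
      · exact mem_children.2 ⟨hp, hva⟩
      · obtain ⟨hd, hr⟩ := h _ hp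
        have hempty : T.children (T.parent v) = ∅ := by
          simpa [deg, hr] using hd
        by_cases hv : v = T.parent v
        · rwa [← hv] at hp
        · have : v ∈ T.children (T.parent v) := mem_children.2 ⟨rfl, hv⟩
          simp [hempty] at this
  · rintro (rfl | hv)
    · exact ⟨0, rfl⟩
    · exact desc_of_mem_children hv

theorem eq_of_desc_rollup {X : Type} {T : DirTree V} {e : X ↪ V} {a : V}
    (hrange : ∀ v, (∃ x, e x = v) ↔ v = a ∨ ¬ T.Desc v a) {x : X}
    (h : T.Desc (e x) a) : e x = a :=
  ((hrange _).1 ⟨x, rfl⟩).resolve_right (not_not_intro h)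

section Embedding

variable {W : Type} [Fintype W] [DecidableEq W] {T : DirTree V} {T' : DirTree W} {e : W ↪ V}

theorem desc_embedding_iff (hpar : ∀ w, e (T'.parent w) = T.parent (e w)) {u w : W} :
    T.Desc (e u) (e w) ↔ T'.Desc u w := by
  have h : ∀ n, e (T'.parent^[n] u) = T.parent^[n] (e u) := fun n =>
    (Function.Semiconj.iterate_right hpar n) u
  simp only [Desc, ← h, e.apply_eq_iff_eq]

theorem mem_children_embedding_iff (hpar : ∀ w, e (T'.parent w) = T.parent (e w)) {u w : W} :
    e u ∈ T.children (e w) ↔ u ∈ T'.children w := by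
  simp only [mem_children, ← hpar, ne_eq, e.apply_eq_iff_eq]

variable {a : V}

theorem children_rollup_center (hpar : ∀ w, e (T'.parent w) = T.parent (e w))
    (hrange : ∀ v, (∃ w, e w = v) ↔ v = a ∨ ¬ T.Desc v a) {w : W}
    (hw : e w = a) : T'.children w = ∅ := by
  refine Finset.eq_empty_of_forall_notMem fun u hu => (mem_children.1 hu).2 (e.injective ?_)
  rw [hw]
  exact eq_of_desc_rollup hrange
    (hw ▸ desc_of_mem_children ((mem_children_embedding_iff hpar).2 hu))

theorem map_children_rollup (hpar : ∀ w, e (T'.parent w) = T.parent (e w))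
    (hrange : ∀ v, (∃ w, e w = v) ↔ v = a ∨ ¬ T.Desc v a) {w : W}
    (hw : e w ≠ a) : (T'.children w).map e = T.children (e w) := by
  ext v
  rw [Finset.mem_map]
  constructor
  · rintro ⟨u, hu, rfl⟩
    exact (mem_children_embedding_iff hpar).2 hu
  · intro hv
    obtain ⟨u, rfl⟩ : ∃ u, e u = v := by
      rw [hrange, or_iff_not_imp_left]
      intro hva hd
      have hd' := (desc_iff_eq_or_desc_parent.1 hd).resolve_left hva
      rw [(mem_children.1 hv).1] at hd'
      exact hw (eq_of_desc_rollup hrange hd')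
    exact ⟨u, (mem_children_embedding_iff hpar).1 hv, rfl⟩

theorem deg_rollup (hroot : e T'.root = T.root)
    (hpar : ∀ w, e (T'.parent w) = T.parent (e w))
    (hrange : ∀ v, (∃ w, e w = v) ↔ v = a ∨ ¬ T.Desc v a) {w : W}
    (hw : e w ≠ a) : T'.deg w = T.deg (e w) := by
  simp only [deg, ← map_children_rollup hpar hrange hw, Finset.card_map, ← hroot,
    e.apply_eq_iff_eq]

/-- Rolling up the subordinate group of `a` into `a` preserves the subordinate weights of the
remaining vertices. -/
theorem f_rollup (hpar : ∀ w, e (T'.parent w) = T.parent (e w))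
    (hrange : ∀ v, (∃ w, e w = v) ↔ v = a ∨ ¬ T.Desc v a)
    (μ : V → ℝ) (w : W) :
    T'.f (fun u => if e u = a then T.f μ a else μ (e u)) w = T.f μ (e w) := by
  obtain ⟨a', ha'⟩ := (hrange a).2 (Or.inl rfl)
  have hg : ∀ v, ∃ u, if T.Desc v a then u = a' else e u = v := by
    intro v
    split_ifs with hv
    · exact ⟨a', rfl⟩
    · exact (hrange v).2 (Or.inr hv)
  choose g hg using hg
  have hdesc : ∀ v, T.Desc v (e (g v)) := by
    intro v
    have := hg v
    split_ifs at this with hv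
    · rwa [this, ha']
    · rw [this]; exact ⟨0, rfl⟩
  have hmaps : ∀ v ∈ Finset.univ.filter (fun v => T.Desc v (e w)),
      g v ∈ Finset.univ.filter (fun u => T'.Desc u w) := by
    intro v hv
    rw [Finset.mem_filter_univ] at hv ⊢
    rw [← desc_embedding_iff hpar]
    have := hg v
    split_ifs at this with hva
    · rw [this, ha']
      rcases hva.total hv with h | h
      · exact h
      · rw [eq_of_desc_rollup hrange h]; exact ⟨0, rfl⟩
    · rwa [this]
  unfold f
  rw [← Finset.sum_fiberwise_of_maps_to hmaps]
  refine Finset.sum_congr rfl fun u hu => ?_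
  beta_reduce
  rw [Finset.mem_filter_univ, ← desc_embedding_iff hpar] at hu
  have hfiber : ∀ v, g v = u → T.Desc v (e w) := fun v hv => (hv ▸ hdesc v).trans hu
  split_ifs with hua
  · refine Finset.sum_congr (Finset.ext fun v => ?_) fun _ _ => rfl
    simp only [Finset.mem_filter, Finset.mem_univ, true_and]
    constructor
    · intro hv
      have := hg v
      rw [if_pos hv] at this
      have hgu : g v = u := this.trans (e.injective (ha'.trans hua.symm))
      exact ⟨hfiber v hgu, hgu⟩
    · rintro ⟨-, rfl⟩
      exact hua ▸ hdesc v
  · have hset : Finset.filter (fun v => g v = u)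
        (Finset.univ.filter (fun v => T.Desc v (e w))) = {e u} := by
      ext v
      simp only [Finset.mem_filter, Finset.mem_univ, true_and, Finset.mem_singleton]
      have := hg v
      constructor
      · rintro ⟨-, rfl⟩
        split_ifs at this with hva
        · exact absurd (this ▸ ha') hua
        · exact this.symm
      · rintro rfl
        rw [if_neg fun h => hua (eq_of_desc_rollup hrange h)] at this
        exact ⟨hu, e.injective this⟩
    rw [hset, Finset.sum_singleton]

end Embedding

end DirTree

theorem IsMinimalStar.of_map {X Y : Type} (e : X ↪ Y) {U L : Finset X} {μ : Y → ℝ} {d : Y → ℕ}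
    {m : X} (h : IsMinimalStar (U.map e) μ d (e m) (L.map e)) :
    IsMinimalStar U (fun x => μ (e x)) (fun x => d (e x)) m L := by
  simpa [IsMinimalStar] using h

/-- The rollup of a directed Huffman tree at its first star center is a directed Huffman tree, for
a rollup `T'` presented through an embedding `e` of its vertex set. -/
theorem IsHuffmanSeq.rollup {W : Type} [Fintype W] [DecidableEq W] {T : DirTree V}
    {T' : DirTree W} {e : W ↪ V} {μ : V → ℝ} {d : V → ℕ} {q : ℕ} {c : Fin q → V}
    (hseq : IsHuffmanSeq μ d T c) (hq : 0 < q)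
    (hroot : e T'.root = T.root) (hpar : ∀ w, e (T'.parent w) = T.parent (e w))
    (hrange : ∀ v, (∃ w, e w = v) ↔ v = c ⟨0, hq⟩ ∨ ¬ T.Desc v (c ⟨0, hq⟩)) :
    IsHuffmanDir (fun w => if e w = c ⟨0, hq⟩ then T.f μ (c ⟨0, hq⟩) else μ (e w))
      T'.deg T' := by
  obtain ⟨hdeg, hinj, hint, hlast, hstar⟩ := hseq
  have hle : ∀ w, e w = c ⟨0, hq⟩ → T'.deg w ≤ 1 := by
    intro w hw
    simp only [DirTree.deg, DirTree.children_rollup_center hpar hrange hw, Finset.card_empty]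
    split_ifs <;> simp
  obtain _ | _ | n := q
  · omega
  · refine ⟨0, Fin.elim0, fun _ => rfl, fun i => i.elim0, fun w => ?_, by simp,
      fun i => i.elim0⟩
    have hw : e w = c ⟨0, hq⟩ := by
      refine DirTree.eq_of_desc_rollup hrange ?_
      have := T.reaches (e w)
      rwa [hlast hq] at this
    have := hle w hw
    simp only [IsEmpty.exists_iff, iff_false]
    omega
  set a := c ⟨0, hq⟩ with ha
  have hdroot : 1 < d T.root := (hint _).2 ⟨_, (hlast hq).symm⟩
  have hroot_ne : T.root ≠ a := by
    rw [hlast hq, ha]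
    intro h
    simpa using congrArg Fin.val (hinj h)
  have hstar0 := hstar ⟨0, hq⟩ (by simp)
  have hpend : ∀ v ∈ T.children a, d v = 1 := by
    intro v hv
    have := hstar0.2.2.2.2.2.1 v hv
    simpa [stateD, usedCenters] using this
  have hdesc := DirTree.desc_iff_of_children_pendent (T := T) (a := a) fun v hv =>
    ⟨(hdeg v).trans (hpend v hv), fun h => by have := hpend v hv; rw [h] at this; omega⟩
  have hrange' : ∀ v, (∃ w, e w = v) ↔ v ∉ T.children a := by
    intro v
    rw [hrange, hdesc, not_or]
    have : a ∉ T.children a := by simp [DirTree.mem_children]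
    grind
  have hc : ∀ i : Fin (n + 1), ∃ w, e w = c i.succ := by
    intro i
    rw [hrange']
    intro h
    have h1 := hpend _ h
    have h2 := (hint (c i.succ)).2 ⟨_, rfl⟩
    omega
  choose c' hc' using hc
  have hne : ∀ i, e (c' i) ≠ a := by
    intro i h
    rw [hc', ha] at h
    simpa using congrArg Fin.val (hinj h)
  have hused : ∀ i w, e w ∈ usedCenters c (i + 1) ↔ e w = a ∨ w ∈ usedCenters c' i := by
    intro i w
    simp only [usedCenters, Finset.mem_image, Finset.mem_filter, Finset.mem_univ, true_and]
    rw [Fin.exists_fin_succ]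
    simp only [← hc', e.apply_eq_iff_eq, Fin.val_succ, Nat.add_lt_add_iff_right]
    have h0 : c 0 = a := rfl
    simp [h0, eq_comm]
  have hV : ∀ i, (stateV T' c' i).map e = stateV T c (i + 1) := by
    intro i
    ext v
    simp only [stateV, Finset.mem_map, Finset.mem_sdiff, Finset.mem_univ, true_and,
      Finset.mem_biUnion, Finset.mem_filter]
    rw [Fin.exists_fin_succ]
    simp only [← hc', Fin.val_succ, Nat.add_lt_add_iff_right]
    have h0 : c 0 = a := rfl
    simp only [h0, Fin.val_zero, Nat.zero_lt_succ, true_and, not_or, ← hrange']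
    constructor
    · rintro ⟨w, hw, rfl⟩
      refine ⟨⟨w, rfl⟩, ?_⟩
      simpa only [DirTree.mem_children_embedding_iff hpar] using hw
    · rintro ⟨⟨w, rfl⟩, hw⟩
      refine ⟨w, ?_, rfl⟩
      simpa only [DirTree.mem_children_embedding_iff hpar] using hw
  have hMu : ∀ i, stateMu T' (fun w => if e w = a then T.f μ a else μ (e w)) c' i =
      fun w => stateMu T μ c (i + 1) (e w) := by
    intro i
    ext w
    simp only [stateMu, hused, DirTree.f_rollup hpar hrange]
    by_cases hw : e w = a <;> by_cases hu : w ∈ usedCenters c' i <;> simp [hw, hu]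
  have hdegc : ∀ w, e w = a → T'.deg w = 1 := by
    intro w hw
    have hwr : w ≠ T'.root := fun h => hroot_ne (by rw [← hroot, ← h, hw])
    simp [DirTree.deg, DirTree.children_rollup_center hpar hrange hw, hwr]
  have hdegne : ∀ w, e w ≠ a → T'.deg w = d (e w) := fun w hw =>
    (DirTree.deg_rollup hroot hpar hrange hw).trans (hdeg _)
  have hD : ∀ i, stateD T'.deg c' i = fun w => stateD d c (i + 1) (e w) := by
    intro i
    ext w
    simp only [stateD, hused]
    by_cases hw : e w = a
    · simp [hw, hdegc w hw]
    · simp [hw, hdegne w hw]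
  refine ⟨n + 1, c', fun _ => rfl, ?_, ?_, ?_, ?_⟩
  · intro i j hij
    have := congrArg e hij
    rw [hc', hc'] at this
    exact Fin.succ_injective _ (hinj this)
  · intro w
    by_cases hw : e w = a
    · rw [hdegc w hw]
      simp only [lt_irrefl, false_iff, not_exists]
      rintro j rfl
      exact hne j hw
    · rw [hdegne w hw, hint, Fin.exists_fin_succ]
      simp only [← hc', e.apply_eq_iff_eq]
      exact or_iff_right fun h => hw h.symm
  · intro _
    apply e.injective
    rw [hroot, hlast hq, hc']
    congr 1
  · intro i hi
    rw [hMu, hD]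
    apply IsMinimalStar.of_map
    rw [hV, DirTree.map_children_rollup hpar hrange (hne i), hc']
    exact hstar i.succ (by simp only [Fin.val_succ]; omega)

/-- the `m₁`-rollup of a directed Huffman tree (where `m₁ = c 0` is the
center of the first star) is a directed Huffman tree for the tuple it induces
(`m₁` gets weight `f_H(m₁)`, all other remaining vertices keep their weights, and the
degrees are those in the rollup). The rollup is the tree on the vertices not strictly
subordinate to `m₁`, with the parent map inherited from `H`. -/
theorem huffman_rollup_isHuffman {V : Type} [Fintype V] [DecidableEq V]
    (μ : V → ℝ) (d : V → ℕ) (hgen : IsGenTuple μ d) (hmono : DegMonotone μ d)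
    (H : DirTree V) (q : ℕ) (c : Fin q → V) (hseq : IsHuffmanSeq μ d H c) (hq : 0 < q)
    (H' : DirTree {v : V // v = c ⟨0, hq⟩ ∨ ¬ H.Desc v (c ⟨0, hq⟩)})
    (hroot : (H'.root : V) = H.root)
    (hpar : ∀ w, (H'.parent w : V) = H.parent (w : V)) :
    IsHuffmanDir
      (fun w : {v : V // v = c ⟨0, hq⟩ ∨ ¬ H.Desc v (c ⟨0, hq⟩)} =>
        if (w : V) = c ⟨0, hq⟩ then H.f μ (c ⟨0, hq⟩) else μ (w : V))
      H'.deg H' := by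
  exact hseq.rollup (e := Function.Embedding.subtype _) hq hroot hpar (by simp)
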